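/- Let G be a finite simple graph and S ⊆ V(G) a set of k vertices. If the adjacency matrix of G has more than (r+1)·2^k distinct eigenvalues, then the adjacency matrix of G \ S has more than r distinct eigenvalues. -/

import Mathlib

open Matrix in
/-- Diagonalised quadratic form, in dot-product language. -/
lemma aux_diag {n : Type*} [Fintype n] [DecidableEq n] {A : Matrix n n ℝ} (hA : A.IsHermitian)
    (x : n → ℝ) (c : ℝ) :
    ∑ v, ((A *ᵥ x) v - c * x v) ^ 2 =
      ∑ j, (hA.eigenvalues j - c) ^ 2 * ((hA.eigenvectorBasis j : n → ℝ) ⬝ᵥ x) ^ 2 := by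
  have h1 := hA.eigenvectorBasis.sum_sq_inner_right (WithLp.toLp 2 (A *ᵥ x - c • x))
  rw [EuclideanSpace.real_norm_sq_eq] at h1
  have h2 : ∑ v, ((A *ᵥ x) v - c * x v) ^ 2 =
      ∑ i, ((WithLp.toLp 2 (A *ᵥ x - c • x) : EuclideanSpace ℝ n) i) ^ 2 := by
    simp
  rw [h2, ← h1]
  refine Finset.sum_congr rfl fun j _ => ?_
  rw [← mul_pow]
  congr 1
  have hT : Aᵀ = A := by simpa using hA.eq
  have h3 : (hA.eigenvectorBasis j : n → ℝ) ⬝ᵥ (A *ᵥ x) =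
      hA.eigenvalues j * ((hA.eigenvectorBasis j : n → ℝ) ⬝ᵥ x) := by
    rw [dotProduct_mulVec, ← mulVec_transpose, hT, hA.mulVec_eigenvectorBasis, smul_dotProduct,
      smul_eq_mul]
  rw [EuclideanSpace.inner_eq_star_dotProduct]
  simp only [star_trivial]
  rw [dotProduct_comm, dotProduct_sub, h3, dotProduct_smul, smul_eq_mul]
  ring

open Matrix in
lemma aux_norm {n : Type*} [Fintype n] [DecidableEq n] {A : Matrix n n ℝ} (hA : A.IsHermitian)
    (x : n → ℝ) :
    ∑ v, (x v) ^ 2 = ∑ j, ((hA.eigenvectorBasis j : n → ℝ) ⬝ᵥ x) ^ 2 := by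
  have h1 := hA.eigenvectorBasis.sum_sq_inner_right (WithLp.toLp 2 x)
  rw [EuclideanSpace.real_norm_sq_eq] at h1
  refine h1.symm.trans (Finset.sum_congr rfl fun j _ => ?_)
  rw [EuclideanSpace.inner_eq_star_dotProduct]
  simp only [star_trivial]
  rw [dotProduct_comm]

open Matrix in
/-- Interlacing: more than `|S|` eigenvalues of `A` in `[c-δ, c+δ]` force one of the submatrix. -/
lemma aux_interlace {V : Type*} [Fintype V] [DecidableEq V] {A : Matrix V V ℝ}
    (hA : A.IsHermitian) (S : Finset V)
    {B : Matrix {v : V // v ∉ S} {v : V // v ∉ S} ℝ}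
    (hBA : B = A.submatrix (fun v : {v : V // v ∉ S} => (v : V))
      (fun v : {v : V // v ∉ S} => (v : V)))
    (hB : B.IsHermitian) (J : Finset V) (hJ : S.card < J.card) (c δ : ℝ)
    (hJδ : ∀ j ∈ J, |hA.eigenvalues j - c| ≤ δ) :
    ∃ i, |hB.eigenvalues i - c| ≤ δ := by
  by_contra! hcon
  let f : (V → ℝ) →ₗ[ℝ] ((S → ℝ) × ((Jᶜ : Finset V) → ℝ)) :=
    { toFun := fun x => (fun s => x s, fun j => (hA.eigenvectorBasis j : V → ℝ) ⬝ᵥ x)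
      map_add' := by
        intro x y
        ext <;> simp [dotProduct_add]
      map_smul' := by
        intro a x
        ext <;> simp [dotProduct_smul] }
  have hker : LinearMap.ker f ≠ ⊥ := by
    apply LinearMap.ker_ne_bot_of_finrank_lt
    have h1 := Finset.card_le_univ J
    have h2 := Finset.card_compl J
    rw [Module.finrank_prod, Module.finrank_fintype_fun_eq_card, Module.finrank_fintype_fun_eq_card,
      Module.finrank_fintype_fun_eq_card, Fintype.card_coe, Fintype.card_coe]
    omega
  obtain ⟨x, hx, hx0⟩ := (Submodule.ne_bot_iff _).1 hker
  have hx' : f x = 0 := hx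
  have hxS : ∀ v ∈ S, x v = 0 := fun v hv => congrFun (congrArg Prod.fst hx') ⟨v, hv⟩
  have hxJ : ∀ j ∉ J, (hA.eigenvectorBasis j : V → ℝ) ⬝ᵥ x = 0 := fun j hj =>
    congrFun (congrArg Prod.snd hx') ⟨j, by simpa using hj⟩
  have hsplit : ∀ g : V → ℝ, ∑ v, g v = ∑ v ∈ S, g v + ∑ v : {v : V // v ∉ S}, g v := by
    intro g
    rw [← Finset.sum_add_sum_compl S g]
    congr 1
    exact (Finset.sum_subtype _ (by simp) g)
  let y : {v : V // v ∉ S} → ℝ := fun v => x v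
  have hBy : ∀ v : {v : V // v ∉ S}, (B *ᵥ y) v = (A *ᵥ x) v := by
    intro v
    simp only [mulVec, dotProduct]
    have h0 : ∑ w ∈ S, A v w * x w = 0 := Finset.sum_eq_zero fun w hw => by simp [hxS w hw]
    rw [hsplit fun w => A v w * x w, h0, zero_add]
    simp [hBA, y]
  have hnorm : ∑ v, (x v) ^ 2 = ∑ v, (y v) ^ 2 := by
    rw [hsplit, Finset.sum_eq_zero, zero_add]
    intro w hw
    simp [hxS w hw]
  have hle : ∑ v, ((B *ᵥ y) v - c * y v) ^ 2 ≤ ∑ v, ((A *ᵥ x) v - c * x v) ^ 2 := by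
    rw [hsplit fun v => ((A *ᵥ x) v - c * x v) ^ 2]
    simp only [hBy, y]
    exact le_add_of_nonneg_left (Finset.sum_nonneg fun _ _ => sq_nonneg _)
  have hup : ∑ v, ((A *ᵥ x) v - c * x v) ^ 2 ≤ δ ^ 2 * ∑ v, (x v) ^ 2 := by
    rw [aux_diag hA, aux_norm hA, Finset.mul_sum]
    refine Finset.sum_le_sum fun j _ => ?_
    by_cases hj : j ∈ J
    · refine mul_le_mul_of_nonneg_right ?_ (sq_nonneg _)
      rw [← sq_abs (_ - c)]
      exact pow_le_pow_left₀ (abs_nonneg _) (hJδ j hj) 2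
    · simp [hxJ j hj]
  have hδ : 0 ≤ δ := by
    obtain ⟨j, hj⟩ := Finset.card_pos.1 (lt_of_le_of_lt (Nat.zero_le _) hJ)
    exact (abs_nonneg _).trans (hJδ j hj)
  have hpos : 0 < ∑ v, (y v) ^ 2 := by
    rw [← hnorm]
    obtain ⟨v, hv⟩ := Function.ne_iff.1 hx0
    exact Finset.sum_pos' (fun _ _ => sq_nonneg _) ⟨v, Finset.mem_univ _, by
      have : x v ≠ 0 := hv
      positivity⟩
  have hlow : δ ^ 2 * ∑ v, (y v) ^ 2 < ∑ v, ((B *ᵥ y) v - c * y v) ^ 2 := by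
    have hsq : ∀ i, δ ^ 2 < (hB.eigenvalues i - c) ^ 2 := by
      intro i
      rw [← sq_abs (_ - c)]
      exact pow_lt_pow_left₀ (hcon i) hδ two_ne_zero
    rw [aux_norm hB] at hpos
    rw [aux_diag hB, aux_norm hB, Finset.mul_sum]
    obtain ⟨i, hi, hi0⟩ := Finset.exists_ne_zero_of_sum_ne_zero hpos.ne'
    refine Finset.sum_lt_sum (fun j _ => mul_le_mul_of_nonneg_right (hsq j).le (sq_nonneg _))
      ⟨i, hi, mul_lt_mul_of_pos_right (hsq i) (lt_of_le_of_ne (sq_nonneg _) hi0.symm)⟩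
  rw [← hnorm] at hlow
  linarith

theorem stmt_8 {V : Type*} [Fintype V] [DecidableEq V] (G : SimpleGraph V)
    [DecidableRel G.Adj] (S : Finset V) (k r : ℕ) (hS : S.card = k)
    (h : (r + 1) * 2 ^ k < (spectrum ℝ (G.adjMatrix ℝ)).ncard) :
    r < (spectrum ℝ ((G.adjMatrix ℝ).submatrix
        (fun v : {v : V // v ∉ S} => (v : V))
        (fun v : {v : V // v ∉ S} => (v : V)))).ncard := by
  classical
  have hA : (G.adjMatrix ℝ).IsHermitian := G.isHermitian_adjMatrix ℝ
  have hB := hA.submatrix (fun v : {v : V // v ∉ S} => (v : V))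
  set T : Finset ℝ := Finset.univ.image hA.eigenvalues with hT
  set M : Finset ℝ := Finset.univ.image hB.eigenvalues with hM
  have hTs : spectrum ℝ (G.adjMatrix ℝ) = (T : Set ℝ) := by
    rw [hA.spectrum_real_eq_range_eigenvalues]; simp [hT]
  have hMs : spectrum ℝ ((G.adjMatrix ℝ).submatrix
        (fun v : {v : V // v ∉ S} => (v : V))
        (fun v : {v : V // v ∉ S} => (v : V))) = (M : Set ℝ) := by
    rw [hB.spectrum_real_eq_range_eigenvalues]; simp [hM]
  rw [hTs, Set.ncard_coe_finset] at h
  rw [hMs, Set.ncard_coe_finset]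
  by_contra! hr
  have hk : k + 1 ≤ 2 ^ k := Nat.lt_two_pow_self
  have hcard : (Finset.range (M.card + 1)).card * k < (T \ M).card := by
    have h1 := Finset.le_card_sdiff M T
    have h2 : (r + 1) * (k + 1) ≤ (r + 1) * 2 ^ k := Nat.mul_le_mul_left _ hk
    have h3 : (M.card + 1) * (k + 1) ≤ (r + 1) * (k + 1) := Nat.mul_le_mul_right _ (by omega)
    rw [Finset.card_range]
    have h4 : (M.card + 1) * (k + 1) = (M.card + 1) * k + (M.card + 1) := by ring
    omega
  obtain ⟨q, -, hq⟩ := Finset.exists_lt_card_fiber_of_mul_lt_card_of_maps_to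
    (f := fun t : ℝ => (M.filter (· < t)).card)
    (fun t _ => Finset.mem_range.2 (Nat.lt_succ_of_le (Finset.card_filter_le _ _))) hcard
  set F := (T \ M).filter (fun t : ℝ => (M.filter (· < t)).card = q) with hF
  have hne : F.Nonempty := Finset.card_pos.1 (by omega)
  have ha := F.min'_mem hne
  have hb := F.max'_mem hne
  have hab : F.min' hne ≤ F.max' hne := Finset.min'_le _ _ hb
  have hFle : ∀ t ∈ F, F.min' hne ≤ t ∧ t ≤ F.max' hne := fun t ht =>
    ⟨Finset.min'_le _ _ ht, Finset.le_max' _ _ ht⟩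
  generalize F.min' hne = a at *
  generalize F.max' hne = b at *
  set J : Finset V := Finset.univ.filter (fun j => hA.eigenvalues j ∈ F) with hJ
  have hFJ : F ⊆ J.image hA.eigenvalues := by
    intro t ht
    have : t ∈ T := (Finset.mem_sdiff.1 (Finset.mem_filter.1 ht).1).1
    obtain ⟨j, -, rfl⟩ := Finset.mem_image.1 this
    exact Finset.mem_image.2 ⟨j, by simp [hJ, ht], rfl⟩
  have hJc : S.card < J.card := by
    have := (Finset.card_le_card hFJ).trans Finset.card_image_le
    omega
  obtain ⟨i, hi⟩ := aux_interlace hA S rfl hB J hJc ((a + b) / 2) ((b - a) / 2) (by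
    intro j hj
    have := hFle _ (Finset.mem_filter.1 hj).2
    rw [abs_le]
    constructor <;> linarith [this.1, this.2])
  have hiM : hB.eigenvalues i ∈ M := by simp [hM]
  generalize hB.eigenvalues i = μ at *
  rw [abs_le] at hi
  simp only [hF, Finset.mem_filter, Finset.mem_sdiff] at ha hb
  have haμ : a ≤ μ := by linarith [hi.1]
  have hbμ : μ < b := lt_of_le_of_ne (by linarith [hi.2]) (by rintro rfl; exact hb.1.2 hiM)
  have hlt : (M.filter (· < a)).card < (M.filter (· < b)).card := by
    apply Finset.card_lt_card
    rw [Finset.ssubset_iff_of_subset]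
    · exact ⟨μ, by simp [hiM, hbμ], by simp [haμ]⟩
    · intro z hz
      simp only [Finset.mem_filter] at hz ⊢
      exact ⟨hz.1, hz.2.trans_le hab⟩
  omega
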